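/- arXiv:2209.03437 — 2 statements merged into one kernel-verified Lean document; each statement's English description precedes it below -/
import Mathlib

section
/- Let Y be a real n×r matrix, let σ = ‖Y‖₂ denote its operator (spectral) norm, and set σ_max = 1 − (√(σ⁴ + 4σ²) − σ²)/2. Then for every real n×r matrix D_X and every real n×n matrix D_Z, one has ‖D_X‖_F² + ‖D_Z − D_X Yᵀ‖_F² ≥ σ_max · (‖D_X‖_F² + ‖D_Z‖_F²). -/
open Matrix BigOperators

/-- Frobenius norm of a real matrix. -/
noncomputable def fnorm {n r : ℕ} (A : Matrix (Fin n) (Fin r) ℝ) : ℝ :=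
  Real.sqrt (∑ i, ∑ j, (A i j) ^ 2)

/-- Operator (spectral) norm of a real `n × r` matrix, i.e. the norm of the induced
linear map between Euclidean spaces. -/
noncomputable def specNorm {n r : ℕ} (Y : Matrix (Fin n) (Fin r) ℝ) : ℝ :=
  ‖LinearMap.toContinuousLinearMap (Matrix.toEuclideanLin Y)‖

theorem fnorm_sq {n r : ℕ} (A : Matrix (Fin n) (Fin r) ℝ) :
    fnorm A ^ 2 = ∑ i, ∑ j, A i j ^ 2 :=
  Real.sq_sqrt (Finset.sum_nonneg fun _ _ => Finset.sum_nonneg fun _ _ => sq_nonneg _)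

theorem fnorm_eq_zero {n r : ℕ} {A : Matrix (Fin n) (Fin r) ℝ} (h : fnorm A ^ 2 = 0) : A = 0 := by
  rw [fnorm_sq] at h
  ext i j
  have hi := (Finset.sum_eq_zero_iff_of_nonneg
    fun _ _ => Finset.sum_nonneg fun _ _ => sq_nonneg _).mp h i (Finset.mem_univ i)
  have hij := (Finset.sum_eq_zero_iff_of_nonneg
    fun _ _ => sq_nonneg _).mp hi j (Finset.mem_univ j)
  exact pow_eq_zero_iff two_ne_zero |>.mp hij

theorem sum_mulVec_sq_le {n r : ℕ} (Y : Matrix (Fin n) (Fin r) ℝ) (x : Fin r → ℝ) :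
    ∑ j, (Y *ᵥ x) j ^ 2 ≤ specNorm Y ^ 2 * ∑ k, x k ^ 2 := by
  have h := (LinearMap.toContinuousLinearMap (Matrix.toEuclideanLin Y)).le_opNorm (WithLp.toLp 2 x)
  have h2 := pow_le_pow_left₀ (norm_nonneg _) h 2
  rw [mul_pow, EuclideanSpace.norm_sq_eq, EuclideanSpace.norm_sq_eq] at h2
  simpa [specNorm] using h2

theorem fnorm_mul_transpose_sq_le {m n r : ℕ} (X : Matrix (Fin m) (Fin r) ℝ)
    (Y : Matrix (Fin n) (Fin r) ℝ) :
    fnorm (X * Yᵀ) ^ 2 ≤ specNorm Y ^ 2 * fnorm X ^ 2 := by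
  rw [fnorm_sq, fnorm_sq, Finset.mul_sum]
  refine Finset.sum_le_sum fun i _ => ?_
  have h : ∀ j, (X * Yᵀ) i j = (Y *ᵥ X i) j := fun j => by
    simp [Matrix.mul_apply, Matrix.mulVec, dotProduct, mul_comm]
  simpa only [h] using sum_mulVec_sq_le Y (X i)

/-- Young's inequality for the Frobenius norm, with weight `t`. -/
theorem mul_fnorm_sub_sq_ge {n r : ℕ} (Z A : Matrix (Fin n) (Fin r) ℝ) (t : ℝ) :
    t * (1 - t) * fnorm Z ^ 2 - (1 - t) * fnorm A ^ 2 ≤ t * fnorm (Z - A) ^ 2 := by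
  simp only [fnorm_sq, Finset.mul_sum, ← Finset.sum_sub_distrib]
  refine Finset.sum_le_sum fun i _ => Finset.sum_le_sum fun j _ => ?_
  rw [Matrix.sub_apply]
  nlinarith [sq_nonneg (t * Z i j - A i j)]

/-- For `σ = ‖Y‖₂` and `σ_max = 1 − (√(σ⁴ + 4σ²) − σ²)/2`, for all `D_X, D_Z`:
`‖D_X‖_F² + ‖D_Z − D_X Yᵀ‖_F² ≥ σ_max (‖D_X‖_F² + ‖D_Z‖_F²)`. -/
theorem hessian_block_lower_bound {n r : ℕ} (Y : Matrix (Fin n) (Fin r) ℝ)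
    (σ : ℝ) (hσ : σ = specNorm Y)
    (σmax : ℝ) (hσmax : σmax = 1 - (Real.sqrt (σ ^ 4 + 4 * σ ^ 2) - σ ^ 2) / 2) :
    ∀ (DX : Matrix (Fin n) (Fin r) ℝ) (DZ : Matrix (Fin n) (Fin n) ℝ),
      fnorm DX ^ 2 + fnorm (DZ - DX * Yᵀ) ^ 2 ≥ σmax * (fnorm DX ^ 2 + fnorm DZ ^ 2) := by
  intro DX DZ
  have hA := fnorm_mul_transpose_sq_le DX Y
  rw [← hσ] at hA
  have hs := Real.sq_sqrt (show 0 ≤ σ ^ 4 + 4 * σ ^ 2 by positivity)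
  have hge : σ ^ 2 ≤ √(σ ^ 4 + 4 * σ ^ 2) := Real.le_sqrt_of_sq_le (by nlinarith [sq_nonneg σ])
  have hle : √(σ ^ 4 + 4 * σ ^ 2) ≤ σ ^ 2 + 2 :=
    Real.sqrt_le_iff.mpr ⟨by positivity, by nlinarith⟩
  obtain ⟨t, ht⟩ : ∃ t, t = (√(σ ^ 4 + 4 * σ ^ 2) - σ ^ 2) / 2 := ⟨_, rfl⟩
  have hquad : t ^ 2 = (1 - t) * σ ^ 2 := by rw [ht]; linear_combination hs / 4
  have ht0 : 0 ≤ t := by linarith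
  have ht1 : t ≤ 1 := by linarith
  rw [← ht] at hσmax
  subst hσmax
  rcases ht0.eq_or_lt with h0 | hpos
  · have hσ0 : σ ^ 2 = 0 := by rw [← h0] at hquad; linarith
    rw [hσ0, zero_mul] at hA
    rw [fnorm_eq_zero (le_antisymm hA (sq_nonneg _)), ← h0]
    simp
  · refine le_of_mul_le_mul_left ?_ hpos
    have hX : (1 - t) * fnorm (DX * Yᵀ) ^ 2 ≤ t ^ 2 * fnorm DX ^ 2 := by
      rw [hquad, mul_assoc]
      exact mul_le_mul_of_nonneg_left hA (by linarith)
    linarith [mul_fnorm_sub_sq_ge DZ (DX * Yᵀ) t]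
end

section
/- Let g : ℝ^{n×r} → ℝ be differentiable with L-Lipschitz gradient. Suppose that for k = 1, 2, the matrices X_k, Y_k, U_k, U_{k−1} ∈ ℝ^{n×r} and ρ_k > 0 satisfy the first-order condition ∇g(X_k) + U_{k−1} + ρ_k(X_k − Y_k) = 0 and the dual update U_k = U_{k−1} + ρ_k(X_k − Y_k). Then ‖U_2 − U_1‖_F ≤ L·‖X_2 − X_1‖_F. -/
open Matrix BigOperators

attribute [local instance] Matrix.frobeniusNormedAddCommGroup Matrix.frobeniusNormedSpace

/-- Frobenius inner product `⟨A, B⟩ = Tr(AᵀB) = ∑ᵢⱼ Aᵢⱼ Bᵢⱼ`. -/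
def finner {n r : ℕ} (A B : Matrix (Fin n) (Fin r) ℝ) : ℝ := ∑ i, ∑ j, A i j * B i j

/-- The pairing `H ↦ ⟨G, H⟩` with a fixed matrix `G`, as a continuous linear map
(with respect to the Frobenius norm). -/
noncomputable def pairCLM {n r : ℕ} (G : Matrix (Fin n) (Fin r) ℝ) :
    Matrix (Fin n) (Fin r) ℝ →L[ℝ] ℝ :=
  LinearMap.toContinuousLinearMap
    { toFun := fun H => finner G H
      map_add' := by
        intro H₁ H₂
        simp [finner, mul_add, Finset.sum_add_distrib]
      map_smul' := by
        intro c H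
        simp [finner, Finset.mul_sum, mul_left_comm] }

theorem fnorm_sub_comm {n r : ℕ} (A B : Matrix (Fin n) (Fin r) ℝ) :
    fnorm (A - B) = fnorm (B - A) := by
  simp only [fnorm, Matrix.sub_apply, fun i j => sub_sq_comm (A i j) (B i j)]

/-- At two consecutive ADMM iterations, the dual increments are controlled by
the primal increments: `‖U₂ − U₁‖_F ≤ L ‖X₂ − X₁‖_F`. -/
theorem dual_increment_bounded_by_primal {n r : ℕ} (L : ℝ)
    (g : Matrix (Fin n) (Fin r) ℝ → ℝ)
    (gradg : Matrix (Fin n) (Fin r) ℝ → Matrix (Fin n) (Fin r) ℝ)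
    (hdiff : ∀ A, HasFDerivAt g (pairCLM (gradg A)) A)
    (hLip : ∀ A B, fnorm (gradg A - gradg B) ≤ L * fnorm (A - B))
    (X₁ Y₁ X₂ Y₂ U₀ U₁ U₂ : Matrix (Fin n) (Fin r) ℝ)
    (ρ₁ ρ₂ : ℝ) (hρ₁ : 0 < ρ₁) (hρ₂ : 0 < ρ₂)
    (hopt₁ : gradg X₁ + U₀ + ρ₁ • (X₁ - Y₁) = 0)
    (hdual₁ : U₁ = U₀ + ρ₁ • (X₁ - Y₁))
    (hopt₂ : gradg X₂ + U₁ + ρ₂ • (X₂ - Y₂) = 0)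
    (hdual₂ : U₂ = U₁ + ρ₂ • (X₂ - Y₂)) :
    fnorm (U₂ - U₁) ≤ L * fnorm (X₂ - X₁) := by
  have hU₁ : U₁ = -gradg X₁ := by
    rw [hdual₁, eq_neg_iff_add_eq_zero, ← hopt₁]; abel
  have hU₂ : U₂ = -gradg X₂ := by
    rw [hdual₂, eq_neg_iff_add_eq_zero, ← hopt₂]; abel
  rw [hU₂, hU₁, neg_sub_neg, fnorm_sub_comm X₂ X₁]
  exact hLip X₁ X₂
end
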